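/- arXiv:1806.05239 — 3 statements merged into one kernel-verified Lean document; each statement's English description precedes it below -/
import Mathlib

section
/- In the ring of multivariate formal power series MvPowerSeries (Fin n) ℚ, the series whose coefficient at an exponent vector a : Fin n → ℕ equals 1/(∏_i a_i !) if supp(a) := {i : a_i ≠ 0} is a face of Δ, and equals 0 otherwise, is equal to ∑_{σ ∈ Δ} ∏_{i ∈ σ} E_i, where for each i the series E_i := ∑_{m ≥ 1} X_i^m / m! (i.e. e^{X_i} − 1). -/
/-- The exponential series `e^{X_i} - 1 = ∑_{m ≥ 1} X_i^m / m!` in `MvPowerSeries (Fin n) ℚ`: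
its coefficient at `c` is `1/(c i)!` when `c` is supported exactly on `{i}` (i.e. `c = single i m`
with `m ≥ 1`), and `0` otherwise. -/
def expXsubOne (n : ℕ) (i : Fin n) : MvPowerSeries (Fin n) ℚ :=
  fun c => if c.support = {i} then (1 : ℚ) / (c i).factorial else 0

/-- The finely-graded exponential Hilbert series of the Stanley–Reisner ring of `Δ`:
its coefficient at `a` is `1/∏ᵢ (aᵢ)!` if `supp a ∈ Δ` and `0` otherwise. -/
def expHilbertSR (n : ℕ) (Δ : Finset (Finset (Fin n))) : MvPowerSeries (Fin n) ℚ :=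
  fun a => if a.support ∈ Δ then (1 : ℚ) / ∏ i, ((a i).factorial : ℚ) else 0

theorem coeff_expXsubOne (n : ℕ) (i : Fin n) (a : Fin n →₀ ℕ) :
    MvPowerSeries.coeff a (expXsubOne n i) =
      if a.support = {i} then (1 : ℚ) / (a i).factorial else 0 :=
  rfl

theorem coeff_expHilbertSR (n : ℕ) (Δ : Finset (Finset (Fin n))) (a : Fin n →₀ ℕ) :
    MvPowerSeries.coeff a (expHilbertSR n Δ) =
      if a.support ∈ Δ then (1 : ℚ) / ∏ i, ((a i).factorial : ℚ) else 0 :=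
  rfl

theorem coeff_prod_expXsubOne (n : ℕ) (s : Finset (Fin n)) (a : Fin n →₀ ℕ) :
    MvPowerSeries.coeff a (∏ i ∈ s, expXsubOne n i) =
      if a.support = s then (1 : ℚ) / ∏ i ∈ s, ((a i).factorial : ℚ) else 0 := by
  induction s using Finset.induction_on generalizing a with
  | empty => simp [MvPowerSeries.coeff_one]
  | insert i s hi ih =>
    rw [Finset.prod_insert hi, MvPowerSeries.coeff_mul,
      Finset.sum_eq_single (Finsupp.single i (a i), a.erase i)]
    · have hs : ∏ j ∈ s, (((a.erase i) j).factorial : ℚ) = ∏ j ∈ s, ((a j).factorial : ℚ) :=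
        Finset.prod_congr rfl fun j hj => by
          rw [Finsupp.erase_ne (ne_of_mem_of_not_mem hj hi)]
      simp only [coeff_expXsubOne, ih, hs, Finsupp.support_erase, Finsupp.single_eq_same]
      by_cases ha : a i = 0
      · have h : a.support ≠ insert i s := fun h =>
          Finsupp.mem_support_iff.1 (h.symm ▸ Finset.mem_insert_self i s) ha
        simp [ha, h, (Finset.singleton_ne_empty i).symm]
      · have h : a.support.erase i = s ↔ a.support = insert i s := by
          rw [Finset.erase_eq_iff_eq_insert (Finsupp.mem_support_iff.2 ha) hi]
        simp only [h, Finsupp.support_single i ha, if_true, Finset.prod_insert hi]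
        split_ifs
        · field_simp
        · simp
    · rintro ⟨b, c⟩ hbc hne
      rw [Finset.HasAntidiagonal.mem_antidiagonal] at hbc
      simp only [coeff_expXsubOne, ih]
      split_ifs with hb hc
      · refine absurd ?_ hne
        have hci : c i = 0 := Finsupp.notMem_support_iff.1 (hc ▸ hi)
        have hbj : ∀ j, j ≠ i → b j = 0 := fun j hj =>
          Finsupp.notMem_support_iff.1 (by simp [hb, hj])
        subst hbc
        ext j
        · by_cases hj : j = i
          · subst hj; simp [hci]
          · simp [hbj j hj, hj]
        · by_cases hj : j = i
          · subst hj; simp [hci]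
          · simp [hbj j hj, hj]
      all_goals simp
    · intro h
      exact absurd (Finset.HasAntidiagonal.mem_antidiagonal.2 (Finsupp.single_add_erase i a)) h

theorem fine_exponential_hilbert_series_stanley_reisner
    (n : ℕ) (Δ : Finset (Finset (Fin n)))
    (hempty : ∅ ∈ Δ)
    (hdown : ∀ σ ∈ Δ, ∀ τ ⊆ σ, τ ∈ Δ) :
    expHilbertSR n Δ = ∑ σ ∈ Δ, ∏ i ∈ σ, expXsubOne n i := by
  ext a
  have ha : ∏ i ∈ a.support, ((a i).factorial : ℚ) = ∏ i, ((a i).factorial : ℚ) :=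
    Finset.prod_subset (Finset.subset_univ _) fun i _ hi => by
      simp [Finsupp.notMem_support_iff.1 hi]
  simp only [map_sum, coeff_prod_expXsubOne, coeff_expHilbertSR, Finset.sum_ite_eq, ha]
end

section
/- Suppose that for every vertex v of Δ the link Lk v satisfies e_{Lk v}(t) = (−1)^{d−1} f_{Lk v}(−t) as polynomials in ℤ[t]. Then e_Δ(t) + (−1)^{d+1} f_Δ(−t) is the constant polynomial e_0(Δ) + (−1)^{d+1}. In particular, Δ has weak Property E. -/
open Polynomial

/-- `f_{i-1}(Γ)`: the number of faces of `Γ` of cardinality `i`. -/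
def faceCount (n : ℕ) (Γ : Finset (Finset (Fin n))) (i : ℕ) : ℕ :=
  (Γ.filter fun σ => σ.card = i).card

/-- The `f`-polynomial `f_Γ(t) = ∑_{i ≥ 0} f_{i−1}(Γ) t^i` (faces of a complex on `Fin n`
have cardinality at most `n`). -/
noncomputable def fPoly (n : ℕ) (Γ : Finset (Finset (Fin n))) : Polynomial ℤ :=
  ∑ i ∈ Finset.range (n + 1), C (faceCount n Γ i : ℤ) * X ^ i

/-- The `e`-polynomial `e_Γ(t) = f_Γ(t − 1)`; the `e`-vector consists of its coefficients. -/
noncomputable def ePoly (n : ℕ) (Γ : Finset (Finset (Fin n))) : Polynomial ℤ :=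
  (fPoly n Γ).comp (X - 1)

/-- The link of a vertex `v`: `Lk v = {σ ∈ Δ : v ∉ σ and σ ∪ {v} ∈ Δ}`. -/
def link (n : ℕ) (Δ : Finset (Finset (Fin n))) (v : Fin n) : Finset (Finset (Fin n)) :=
  Δ.filter fun σ => v ∉ σ ∧ insert v σ ∈ Δ

theorem fPoly_eq_sum_X_pow_card (n : ℕ) (Γ : Finset (Finset (Fin n))) :
    fPoly n Γ = ∑ σ ∈ Γ, (X : ℤ[X]) ^ σ.card := by
  have hcard : ∀ σ ∈ Γ, σ.card ∈ Finset.range (n + 1) := fun σ _ =>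
    Finset.mem_range.2 (Nat.lt_succ_of_le (by simpa using σ.card_le_univ))
  rw [fPoly, ← Finset.sum_fiberwise_of_maps_to hcard]
  refine Finset.sum_congr rfl fun i _ => ?_
  rw [Finset.sum_congr rfl fun σ hσ => by rw [(Finset.mem_filter.1 hσ).2]]
  simp [faceCount]

theorem coeff_fPoly (n : ℕ) (Γ : Finset (Finset (Fin n))) (k : ℕ) :
    (fPoly n Γ).coeff k = faceCount n Γ k := by
  simp [fPoly_eq_sum_X_pow_card, coeff_X_pow, faceCount, eq_comm]

theorem faceCount_zero (n : ℕ) (Γ : Finset (Finset (Fin n))) (hempty : ∅ ∈ Γ) :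
    faceCount n Γ 0 = 1 := by
  rw [faceCount, Finset.card_eq_one]
  refine ⟨∅, ?_⟩
  ext σ
  simp only [Finset.mem_filter, Finset.card_eq_zero, Finset.mem_singleton]
  exact ⟨fun h => h.2, fun h => ⟨h ▸ hempty, h⟩⟩

theorem fPoly_link (n : ℕ) (Δ : Finset (Finset (Fin n)))
    (hdown : ∀ σ ∈ Δ, ∀ τ ⊆ σ, τ ∈ Δ) (v : Fin n) :
    fPoly n (link n Δ v) = ∑ σ ∈ Δ with v ∈ σ, (X : ℤ[X]) ^ (σ.card - 1) := by
  rw [fPoly_eq_sum_X_pow_card]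
  refine Finset.sum_bij' (fun τ _ => insert v τ) (fun σ _ => σ.erase v) ?_ ?_ ?_ ?_ ?_
  · intro τ hτ
    simp only [link, Finset.mem_filter] at hτ
    simp [hτ.2.2]
  · intro σ hσ
    rw [Finset.mem_filter] at hσ
    simp [link, Finset.insert_erase hσ.2, hσ.1, hdown σ hσ.1 _ (σ.erase_subset v)]
  · intro τ hτ
    simp only [link, Finset.mem_filter] at hτ
    exact Finset.erase_insert hτ.2.1
  · intro σ hσ
    exact Finset.insert_erase (Finset.mem_filter.1 hσ).2
  · intro τ hτ
    simp only [link, Finset.mem_filter] at hτ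
    simp [Finset.card_insert_of_notMem hτ.2.1]

/-- The derivative of the `f`-polynomial is the sum of the `f`-polynomials of the vertex links. -/
theorem derivative_fPoly (n : ℕ) (Δ : Finset (Finset (Fin n)))
    (hdown : ∀ σ ∈ Δ, ∀ τ ⊆ σ, τ ∈ Δ) :
    derivative (fPoly n Δ) = ∑ v, fPoly n (link n Δ v) := by
  simp_rw [fPoly_link n Δ hdown, Finset.sum_filter]
  rw [Finset.sum_comm, fPoly_eq_sum_X_pow_card, derivative_sum]
  refine Finset.sum_congr rfl fun σ _ => ?_
  simp [derivative_X_pow]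

theorem fPoly_link_eq_zero (n : ℕ) (Δ : Finset (Finset (Fin n)))
    (hdown : ∀ σ ∈ Δ, ∀ τ ⊆ σ, τ ∈ Δ) (v : Fin n) (hv : {v} ∉ Δ) :
    fPoly n (link n Δ v) = 0 := by
  rw [fPoly_link n Δ hdown, Finset.filter_false_of_mem, Finset.sum_empty]
  exact fun σ hσ hvσ => hv (hdown σ hσ _ (Finset.singleton_subset_iff.2 hvσ))

theorem links_propertyE_implies_weak_propertyE
    (n d : ℕ) (Δ : Finset (Finset (Fin n)))
    (hempty : ∅ ∈ Δ)
    (hdown : ∀ σ ∈ Δ, ∀ τ ⊆ σ, τ ∈ Δ)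
    (hd : 1 ≤ d)
    (hdim : ∀ σ ∈ Δ, σ.card ≤ d)
    (hmax : ∃ σ ∈ Δ, σ.card = d)
    (hlinks : ∀ v : Fin n, {v} ∈ Δ →
      ePoly n (link n Δ v) = C ((-1 : ℤ) ^ (d - 1)) * (fPoly n (link n Δ v)).comp (-X)) :
    ePoly n Δ + C ((-1 : ℤ) ^ (d + 1)) * (fPoly n Δ).comp (-X) =
        C ((ePoly n Δ).coeff 0 + (-1 : ℤ) ^ (d + 1)) ∧
    (∀ k, 1 ≤ k → k ≤ d →
        (ePoly n Δ).coeff k = (-1 : ℤ) ^ (d - k) * (faceCount n Δ k : ℤ)) := by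
  have hsign : (-1 : ℤ) ^ (d + 1) = (-1) ^ (d - 1) := by
    obtain ⟨m, rfl⟩ := Nat.exists_eq_add_of_le' hd
    simp [pow_succ]
  have hlinks' : ∀ v : Fin n, (fPoly n (link n Δ v)).comp (X - 1) =
      C ((-1 : ℤ) ^ (d + 1)) * (fPoly n (link n Δ v)).comp (-X) := by
    intro v
    by_cases hv : {v} ∈ Δ
    · rw [hsign]
      exact hlinks v hv
    · simp [fPoly_link_eq_zero n Δ hdown v hv]
  have hderiv : derivative (ePoly n Δ + C ((-1 : ℤ) ^ (d + 1)) * (fPoly n Δ).comp (-X)) = 0 := by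
    rw [ePoly, derivative_add, derivative_C_mul, derivative_comp, derivative_comp,
      derivative_fPoly n Δ hdown]
    simp only [Polynomial.sum_comp, hlinks', ← Finset.mul_sum]
    simp
  have hcoeff : ∀ k, ((fPoly n Δ).comp (-X)).coeff k = (-1 : ℤ) ^ k * faceCount n Δ k := by
    intro k
    have hX : (-X : ℤ[X]) = C (-1) * X := by simp
    rw [hX, comp_C_mul_X_coeff, coeff_fPoly, mul_comm]
  have hconst : ePoly n Δ + C ((-1 : ℤ) ^ (d + 1)) * (fPoly n Δ).comp (-X) =
      C ((ePoly n Δ).coeff 0 + (-1 : ℤ) ^ (d + 1)) := by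
    rw [eq_C_of_derivative_eq_zero hderiv, coeff_add, coeff_C_mul, hcoeff,
      faceCount_zero n Δ hempty]
    simp
  refine ⟨hconst, fun k hk hkd => ?_⟩
  have h := congrArg (coeff · k) hconst
  simp only [coeff_add, coeff_C_mul, hcoeff, coeff_C_of_ne_zero (Nat.one_le_iff_ne_zero.1 hk)] at h
  obtain ⟨m, rfl⟩ := Nat.exists_eq_add_of_le hkd
  have hsq : (-1 : ℤ) ^ k * (-1) ^ k = 1 := by rw [← mul_pow]; simp
  rw [Nat.add_sub_cancel_left]
  rw [pow_succ, pow_add] at h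
  linear_combination h + (-1 : ℤ) ^ m * faceCount n Δ k * hsq
end

section
/- If Δ is Eulerian, then Δ has weak Property E, i.e. e_k(Δ) = (−1)^{d−k} f_{k−1}(Δ) for all 1 ≤ k ≤ d. -/
/-- The `e`-vector: `e_k(Δ) = ∑_{i=k}^{d} (−1)^{i−k} (i choose k) f_{i−1}(Δ)`. -/
def eVec (n d : ℕ) (Δ : Finset (Finset (Fin n))) (k : ℕ) : ℤ :=
  ∑ i ∈ Finset.Icc k d, (-1) ^ (i - k) * (i.choose k : ℤ) * (faceCount n Δ i : ℤ)

/-- The reduced Euler characteristic `χ̃(Γ) = ∑_{i ≥ 0} (−1)^i f_i(Γ)`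
(here `f_i` counts faces of cardinality `i+1`, which is at most `n`). -/
def redEuler (n : ℕ) (Γ : Finset (Finset (Fin n))) : ℤ :=
  ∑ i ∈ Finset.range n, (-1) ^ i * (faceCount n Γ (i + 1) : ℤ)

/-- The link of a face `σ`: `Lk σ = {τ ∈ Δ : τ ∩ σ = ∅ and τ ∪ σ ∈ Δ}`. -/
def linkFace (n : ℕ) (Δ : Finset (Finset (Fin n))) (σ : Finset (Fin n)) :
    Finset (Finset (Fin n)) :=
  Δ.filter fun τ => τ ∩ σ = ∅ ∧ τ ∪ σ ∈ Δ

/-- Sums weighted by face numbers are sums over faces. -/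
lemma sum_mul_faceCount (n : ℕ) (Γ : Finset (Finset (Fin n))) (S : Finset ℕ) (g : ℕ → ℤ) :
    ∑ i ∈ S, g i * (faceCount n Γ i : ℤ) = ∑ τ ∈ Γ, if τ.card ∈ S then g τ.card else 0 := by
  have h (i : ℕ) : g i * (faceCount n Γ i : ℤ) = ∑ τ ∈ Γ, if τ.card = i then g i else 0 := by
    rw [← Finset.sum_filter, Finset.sum_const, faceCount, nsmul_eq_mul, mul_comm]
  simp_rw [h]
  rw [Finset.sum_comm]
  simp

/-- The alternating count of all faces, the empty one included. -/
lemma sum_neg_one_pow_card (n : ℕ) (Γ : Finset (Finset (Fin n))) (h : ∅ ∈ Γ) :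
    ∑ τ ∈ Γ, (-1 : ℤ) ^ τ.card = 1 - redEuler n Γ := by
  have hempty : faceCount n Γ 0 = 1 := by
    rw [faceCount, Finset.card_eq_one]
    exact ⟨∅, by ext σ; simp only [Finset.mem_filter, Finset.card_eq_zero,
      Finset.mem_singleton]; grind⟩
  have hsum := sum_mul_faceCount n Γ (Finset.range (n + 1)) fun i => (-1) ^ i
  have hcard (τ : Finset (Fin n)) : τ.card ∈ Finset.range (n + 1) :=
    Finset.mem_range_succ_iff.mpr (card_finset_fin_le τ)
  simp only [hcard, if_true] at hsum
  rw [← hsum, Finset.sum_range_succ', redEuler, hempty]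
  simp [pow_succ, Finset.sum_neg_distrib]
  ring

/-- Faces containing `σ` correspond to faces of the link of `σ`. -/
lemma sum_neg_one_pow_card_superset (n : ℕ) (Δ : Finset (Finset (Fin n)))
    (hdown : ∀ σ ∈ Δ, ∀ τ ⊆ σ, τ ∈ Δ) (σ : Finset (Fin n)) :
    ∑ τ ∈ Δ with σ ⊆ τ, (-1 : ℤ) ^ (τ.card - σ.card) =
      ∑ τ ∈ linkFace n Δ σ, (-1 : ℤ) ^ τ.card := by
  refine Finset.sum_bij' (fun τ _ => τ \ σ) (fun τ _ => τ ∪ σ) ?_ ?_ ?_ ?_ ?_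
  · intro τ hτ
    obtain ⟨hτ, hσ⟩ := Finset.mem_filter.mp hτ
    refine Finset.mem_filter.mpr ⟨hdown τ hτ _ Finset.sdiff_subset, by simp, ?_⟩
    rwa [Finset.sdiff_union_of_subset hσ]
  · intro τ hτ
    exact Finset.mem_filter.mpr ⟨(Finset.mem_filter.mp hτ).2.2, Finset.subset_union_right⟩
  · intro τ hτ
    exact Finset.sdiff_union_of_subset (Finset.mem_filter.mp hτ).2
  · intro τ hτ
    exact Finset.union_sdiff_cancel_right
      (Finset.disjoint_iff_inter_eq_empty.mpr (Finset.mem_filter.mp hτ).2.1)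
  · intro τ hτ
    rw [Finset.card_sdiff_of_subset (Finset.mem_filter.mp hτ).2]

/-- The `e`-vector as a sum over pairs of nested faces. -/
lemma eVec_eq_sum_superset (n d : ℕ) (Δ : Finset (Finset (Fin n)))
    (hdown : ∀ σ ∈ Δ, ∀ τ ⊆ σ, τ ∈ Δ) (hdim : ∀ σ ∈ Δ, σ.card ≤ d) (k : ℕ) :
    eVec n d Δ k =
      ∑ σ ∈ Δ with σ.card = k, ∑ τ ∈ Δ with σ ⊆ τ, (-1 : ℤ) ^ (τ.card - σ.card) := by
  rw [eVec, sum_mul_faceCount n Δ _ fun i => (-1) ^ (i - k) * (i.choose k : ℤ),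
    Finset.sum_comm' (t' := Δ) (s' := fun τ => τ.powersetCard k)]
  · refine Finset.sum_congr rfl fun τ hτ => ?_
    rw [Finset.sum_congr rfl fun σ hσ => by rw [(Finset.mem_powersetCard.mp hσ).2],
      Finset.sum_const, Finset.card_powersetCard, nsmul_eq_mul, mul_comm]
    split_ifs with h
    · rfl
    · rw [Nat.choose_eq_zero_of_lt (by grind)]
      simp
  · intro σ τ
    simp only [Finset.mem_filter, Finset.mem_powersetCard]
    grind

theorem eulerian_implies_weak_propertyE
    (n d : ℕ) (Δ : Finset (Finset (Fin n)))
    (hempty : ∅ ∈ Δ)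
    (hdown : ∀ σ ∈ Δ, ∀ τ ⊆ σ, τ ∈ Δ)
    (hd : 1 ≤ d)
    (hdim : ∀ σ ∈ Δ, σ.card ≤ d)
    (hmax : ∃ σ ∈ Δ, σ.card = d)
    (hpure : ∀ σ ∈ Δ, ∃ τ ∈ Δ, σ ⊆ τ ∧ τ.card = d)
    (heuler : ∀ σ ∈ Δ, σ ≠ ∅ →
      redEuler n (linkFace n Δ σ) = 1 + (Int.negOnePow ((d : ℤ) - 1 - σ.card) : ℤ)) :
    ∀ k, 1 ≤ k → k ≤ d → eVec n d Δ k = (-1) ^ (d - k) * (faceCount n Δ k : ℤ) := by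
  intro k hk hkd
  rw [eVec_eq_sum_superset n d Δ hdown hdim, mul_comm, faceCount, ← nsmul_eq_mul]
  refine Finset.sum_eq_card_nsmul fun σ hσ => ?_
  obtain ⟨hσΔ, rfl⟩ := Finset.mem_filter.mp hσ
  have hne : σ ≠ ∅ := Finset.card_pos.mp hk |>.ne_empty
  have hlink : ∅ ∈ linkFace n Δ σ := Finset.mem_filter.mpr ⟨hempty, by simpa using hσΔ⟩
  rw [sum_neg_one_pow_card_superset n Δ hdown, sum_neg_one_pow_card n _ hlink,
    heuler σ hσΔ hne, show (d : ℤ) - 1 - σ.card = ((d - σ.card : ℕ) : ℤ) - 1 by omega,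
    Int.negOnePow_sub, Int.negOnePow_one]
  simp [Int.negOnePow_def]
end
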